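/- Let Γ be a group, F a field of characteristic zero, and let ρ₁ : Γ → GL(V₁) and ρ₂ : Γ → GL(V₂) be two semisimple representations of Γ on n-dimensional F-vector spaces V₁ and V₂. Suppose that for some positive integer k, the k-th tensor power representations T^k(ρ₁) on V₁^{⊗k} and T^k(ρ₂) on V₂^{⊗k} are isomorphic as representations of Γ. Then ρ₁ and ρ₂ are potentially isomorphic: there exists a finite-index subgroup Γ' of Γ such that the restrictions of ρ₁ and ρ₂ to Γ' are isomorphic as representations of Γ'. -/

import Mathlib

open TensorProduct PiTensorProduct

/-- A representation is semisimple if every invariant submodule admits an invariant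
complement (equivalently, the underlying space is a semisimple `F[Γ]`-module). -/
def Representation.IsSemisimpleRep {F Γ V : Type*} [Field F] [Group Γ]
    [AddCommGroup V] [Module F V] (ρ : Representation F Γ V) : Prop :=
  ∀ W : Submodule F V, (∀ γ : Γ, ∀ v ∈ W, ρ γ v ∈ W) →
    ∃ W' : Submodule F V, (∀ γ : Γ, ∀ v ∈ W', ρ γ v ∈ W') ∧ IsCompl W W'

theorem PiTensorProduct.trace_map_const {F V ι : Type*} [Field F] [AddCommGroup V] [Module F V]
    [FiniteDimensional F V] [Fintype ι] (f : V →ₗ[F] V) :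
    LinearMap.trace F (⨂[F] _ : ι, V) (PiTensorProduct.map fun _ => f) =
      LinearMap.trace F V f ^ Fintype.card ι := by
  classical
  let b := Module.finBasis F V
  rw [LinearMap.trace_eq_matrix_trace F (Basis.piTensorProduct fun _ : ι => b),
    LinearMap.trace_eq_matrix_trace F b, Matrix.trace, Matrix.trace, ← Finset.card_univ,
    ← Finset.prod_const, Finset.prod_univ_sum]
  simp [LinearMap.toMatrix_apply]

section TraceDetermines

variable {F A : Type*} [Field F] [Ring A] [Algebra F A]

theorem LinearEquiv.trace_lsmul_eq {M N : Type*}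
    [AddCommGroup M] [Module F M] [Module A M] [IsScalarTower F A M]
    [AddCommGroup N] [Module F N] [Module A N] [IsScalarTower F A N]
    (e : M ≃ₗ[A] N) (a : A) :
    LinearMap.trace F M (Algebra.lsmul F F M a) = LinearMap.trace F N (Algebra.lsmul F F N a) := by
  rw [← LinearMap.trace_conj' (Algebra.lsmul F F M a) (e.restrictScalars F)]
  congr 1
  ext x
  simp [LinearEquiv.conj_apply]

theorem LinearMap.trace_lsmul_prod {M N : Type*}
    [AddCommGroup M] [Module F M] [Module A M] [IsScalarTower F A M] [FiniteDimensional F M]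
    [AddCommGroup N] [Module F N] [Module A N] [IsScalarTower F A N] [FiniteDimensional F N]
    (a : A) :
    LinearMap.trace F (M × N) (Algebra.lsmul F F (M × N) a) =
      LinearMap.trace F M (Algebra.lsmul F F M a) +
        LinearMap.trace F N (Algebra.lsmul F F N a) := by
  rw [← LinearMap.trace_prodMap']
  rfl

theorem exists_smul_fst_eq_and_smul_snd_eq_zero {M N : Type*}
    [AddCommGroup M] [Module F M] [Module A M] [IsScalarTower F A M] [FiniteDimensional F M]
    [AddCommGroup N] [Module F N] [Module A N] [IsScalarTower F A N] [FiniteDimensional F N]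
    [IsSemisimpleModule A M] [IsSemisimpleModule A N]
    (hMN : ∀ f : M →ₗ[A] N, f = 0) (hNM : ∀ f : N →ₗ[A] M, f = 0) :
    ∃ a : A, (∀ m : M, a • m = m) ∧ ∀ n : N, a • n = 0 := by
  classical
  let p : Module.End (Module.End A (M × N)) (M × N) :=
    { toFun := fun x => (x.1, 0)
      map_add' := by simp
      map_smul' := fun φ x => by
        have h₁ : ∀ n : N, (φ (0, n)).1 = 0 := fun n =>
          LinearMap.congr_fun (hNM (LinearMap.fst A M N ∘ₗ φ ∘ₗ LinearMap.inr A M N)) n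
        have h₂ : ∀ m : M, (φ (m, 0)).2 = 0 := fun m =>
          LinearMap.congr_fun (hMN (LinearMap.snd A M N ∘ₗ φ ∘ₗ LinearMap.inl A M N)) m
        have h₃ : φ x = φ (x.1, 0) + φ (0, x.2) := by rw [← map_add]; simp
        ext <;> simp [h₁, h₂, h₃] }
  have : IsSemisimpleModule A (M × N) := by
    have h := IsSemisimpleModule.sup (p := LinearMap.range (LinearMap.inl A M N))
      (q := LinearMap.range (LinearMap.inr A M N))
      (IsSemisimpleModule.range _) (IsSemisimpleModule.range _)
    rw [LinearMap.sup_range_inl_inr] at h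
    exact IsSemisimpleModule.congr Submodule.topEquiv.symm
  obtain ⟨s, hs⟩ := Module.Finite.fg_top (R := F) (M := M × N)
  obtain ⟨a, ha⟩ := jacobson_density p s
  have key : ∀ x : M × N, (x.1, (0 : N)) = a • x := fun x => by
    have hx : x ∈ Submodule.span F (s : Set (M × N)) := hs ▸ Submodule.mem_top
    have : Set.EqOn (LinearMap.prodMap LinearMap.id 0 : M × N →ₗ[F] M × N)
        (Algebra.lsmul F F (M × N) a) s := fun y hy => ha y hy
    exact LinearMap.eqOn_span this hx
  exact ⟨a, fun m => (congrArg Prod.fst (key (m, 0))).symm,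
    fun n => (congrArg Prod.snd (key (0, n))).symm⟩

theorem finrank_eq_zero_of_trace_lsmul_eq [CharZero F] {M N : Type*}
    [AddCommGroup M] [Module F M] [Module A M] [IsScalarTower F A M] [FiniteDimensional F M]
    [AddCommGroup N] [Module F N] [Module A N] [IsScalarTower F A N] [FiniteDimensional F N]
    [IsSemisimpleModule A M] [IsSemisimpleModule A N]
    (hMN : ∀ f : M →ₗ[A] N, f = 0) (hNM : ∀ f : N →ₗ[A] M, f = 0)
    (h : ∀ a : A, LinearMap.trace F M (Algebra.lsmul F F M a) =
      LinearMap.trace F N (Algebra.lsmul F F N a)) :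
    Module.finrank F M = 0 := by
  obtain ⟨a, ha₁, ha₂⟩ :=
    exists_smul_fst_eq_and_smul_snd_eq_zero (F := F) hMN hNM
  have h₁ : Algebra.lsmul F F M a = LinearMap.id := LinearMap.ext ha₁
  have h₂ : Algebra.lsmul F F N a = 0 := LinearMap.ext ha₂
  have := h a
  rw [h₁, h₂, LinearMap.trace_id, map_zero] at this
  exact_mod_cast this

theorem IsSemisimpleModule.exists_linearMap_ne_zero_symm {M N : Type*}
    [AddCommGroup M] [Module A M] [AddCommGroup N] [Module A N]
    [IsSemisimpleModule A M] [IsSemisimpleModule A N]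
    (f : M →ₗ[A] N) (hf : f ≠ 0) : ∃ g : N →ₗ[A] M, g ≠ 0 := by
  obtain ⟨q, hq⟩ := exists_isCompl (LinearMap.range f)
  obtain ⟨g, hg⟩ := IsSemisimpleModule.lifting_property f.rangeRestrict
    f.surjective_rangeRestrict (Submodule.projectionOnto _ q hq)
  refine ⟨g, fun h0 => hf (LinearMap.ext fun m => ?_)⟩
  have := LinearMap.congr_fun hg (f m)
  rw [h0, LinearMap.comp_zero, LinearMap.zero_apply] at this
  have h2 := Submodule.projectionOnto_apply_left hq ⟨f m, m, rfl⟩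
  simpa using congrArg Subtype.val (h2.symm.trans this.symm)

theorem nonempty_linearEquiv_of_trace_lsmul_eq [CharZero F] {M N : Type*}
    [AddCommGroup M] [Module F M] [Module A M] [IsScalarTower F A M] [FiniteDimensional F M]
    [AddCommGroup N] [Module F N] [Module A N] [IsScalarTower F A N] [FiniteDimensional F N]
    [IsSemisimpleModule A M] [IsSemisimpleModule A N]
    (h : ∀ a : A, LinearMap.trace F M (Algebra.lsmul F F M a) =
      LinearMap.trace F N (Algebra.lsmul F F N a)) :
    Nonempty (M ≃ₗ[A] N) := by
  induction hd : Module.finrank F M using Nat.strong_induction_on generalizing M N with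
  | _ d ih =>
  by_cases hMN : ∀ f : M →ₗ[A] N, f = 0
  · have hNM : ∀ f : N →ₗ[A] M, f = 0 := fun f => by
      by_contra hf
      obtain ⟨g, hg⟩ := IsSemisimpleModule.exists_linearMap_ne_zero_symm f hf
      exact hg (hMN g)
    have : Subsingleton M :=
      Module.finrank_zero_iff.mp (finrank_eq_zero_of_trace_lsmul_eq (F := F) hMN hNM h)
    have : Subsingleton N := Module.finrank_zero_iff.mp
      (finrank_eq_zero_of_trace_lsmul_eq (F := F) hNM hMN fun a => (h a).symm)
    exact ⟨0⟩
  · push Not at hMN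
    obtain ⟨f, hf⟩ := hMN
    obtain ⟨p, hp⟩ := exists_isCompl (LinearMap.ker f)
    obtain ⟨q, hq⟩ := exists_isCompl (LinearMap.range f)
    let e₁ : (LinearMap.ker f × LinearMap.range f) ≃ₗ[A] M :=
      (LinearEquiv.prodCongr (.refl _ _)
        (f.quotKerEquivRange.symm ≪≫ₗ Submodule.quotientEquivOfIsCompl _ p hp)) ≪≫ₗ
        Submodule.prodEquivOfIsCompl _ p hp
    let e₂ := Submodule.prodEquivOfIsCompl _ q hq
    have : FiniteDimensional F (LinearMap.ker f) :=
      inferInstanceAs (FiniteDimensional F ((LinearMap.ker f).restrictScalars F))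
    have : FiniteDimensional F (LinearMap.range f) :=
      inferInstanceAs (FiniteDimensional F ((LinearMap.range f).restrictScalars F))
    have : FiniteDimensional F q :=
      inferInstanceAs (FiniteDimensional F (q.restrictScalars F))
    have htr : ∀ a : A, LinearMap.trace F (LinearMap.ker f) (Algebra.lsmul F F _ a) =
        LinearMap.trace F q (Algebra.lsmul F F q a) := fun a => by
      have := h a
      rw [← e₁.trace_lsmul_eq, ← e₂.trace_lsmul_eq, LinearMap.trace_lsmul_prod,
        LinearMap.trace_lsmul_prod, add_comm] at this
      exact add_left_cancel this
    have hlt : Module.finrank F (LinearMap.ker f) < d := by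
      rw [← hd]
      refine Submodule.finrank_lt (s := (LinearMap.ker f).restrictScalars F) fun htop => hf ?_
      rw [Submodule.restrictScalars_eq_top_iff] at htop
      exact LinearMap.ker_eq_top.mp htop
    obtain ⟨e⟩ := ih _ hlt htr rfl
    exact ⟨e₁.symm ≪≫ₗ LinearEquiv.prodComm A _ _ ≪≫ₗ
      LinearEquiv.prodCongr (.refl _ _) e ≪≫ₗ e₂⟩

end TraceDetermines

section RightTranslation

variable {Γ F : Type*} [Group Γ] [Field F]

/-- The action of a group by right translations on a translation-stable algebra of functions. -/
@[reducible]
def Subalgebra.rightTranslationAction (A : Subalgebra F (Γ → F))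
    (hA : ∀ g : Γ, ∀ f ∈ A, (fun x => f (x * g)) ∈ A) : MulSemiringAction Γ A where
  smul g f := ⟨fun x => (f : Γ → F) (x * g), hA g f f.2⟩
  one_smul f := Subtype.ext <| funext fun x => congrArg (f : Γ → F) (mul_one x)
  mul_smul g h f := Subtype.ext <| funext fun x => congrArg (f : Γ → F) (mul_assoc x g h).symm
  smul_zero _ := rfl
  smul_add _ _ _ := rfl
  smul_one _ := rfl
  smul_mul _ _ _ := rfl

open scoped Pointwise in
theorem Ideal.smul_mem_minimalPrimes {G R : Type*} [Group G] [CommRing R] [MulSemiringAction G R]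
    (g : G) {p : Ideal R} (hp : p ∈ minimalPrimes R) : g • p ∈ minimalPrimes R := by
  have hprime : p.IsPrime := hp.1.1
  refine ⟨⟨inferInstance, bot_le⟩, fun q hq hle => ?_⟩
  have hqprime : q.IsPrime := hq.1
  rw [Ideal.subset_pointwise_smul_iff] at hle
  rw [Ideal.pointwise_smul_subset_iff]
  exact hp.2 ⟨inferInstance, bot_le⟩ hle

open scoped Pointwise in
theorem Ideal.finiteIndex_stabilizer_of_mem_minimalPrimes {G R : Type*} [Group G] [CommRing R]
    [IsNoetherianRing R] [MulSemiringAction G R] {p : Ideal R} (hp : p ∈ minimalPrimes R) :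
    (MulAction.stabilizer G p).FiniteIndex := by
  have hfin : (MulAction.orbit G p).Finite :=
    (minimalPrimes.finite_of_isNoetherianRing R).subset <| by
      rintro _ ⟨g, rfl⟩
      exact Ideal.smul_mem_minimalPrimes g hp
  refine ⟨?_⟩
  rw [MulAction.index_stabilizer]
  exact ((Set.ncard_pos hfin).mpr ⟨p, MulAction.mem_orbit_self p⟩).ne'

open scoped Pointwise in
theorem Subalgebra.exists_finiteIndex_eqOn_of_pow_eq (A : Subalgebra F (Γ → F)) (hfg : A.FG)
    (hA : ∀ g : Γ, ∀ f ∈ A, (fun x => f (x * g)) ∈ A)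
    {f h : Γ → F} (hf : f ∈ A) (hh : h ∈ A) {k : ℕ} (hk : 0 < k) (hpow : f ^ k = h ^ k)
    (hone : f 1 = h 1) (hne : h 1 ≠ 0) :
    ∃ N : Subgroup Γ, N.Normal ∧ N.FiniteIndex ∧ ∀ γ ∈ N, f γ = h γ := by
  classical
  let _ := A.rightTranslationAction hA
  have : Algebra.FiniteType F A := A.fg_iff_finiteType.mp hfg
  have : IsNoetherianRing A := Algebra.FiniteType.isNoetherianRing F A
  let ev : A →+* F := (Pi.evalRingHom (fun _ : Γ => F) 1).comp A.val.toRingHom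
  have hm : (RingHom.ker ev).IsPrime := RingHom.ker_isPrime ev
  obtain ⟨p, hp, hpm⟩ := Ideal.exists_minimalPrimes_le (bot_le : ⊥ ≤ RingHom.ker ev)
  have hprime : p.IsPrime := hp.1.1
  have hindex : (MulAction.stabilizer Γ p).FiniteIndex :=
    Ideal.finiteIndex_stabilizer_of_mem_minimalPrimes hp
  let f' : A := ⟨f, hf⟩
  let h' : A := ⟨h, hh⟩
  have hprod : ∏ ζ ∈ Polynomial.nthRootsFinset k (1 : F), (f' - ζ • h') = 0 := by
    ext γ
    have hγ : f γ ^ k = h γ ^ k := congrFun hpow γ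
    rw [SubmonoidClass.coe_finsetProd, Finset.prod_apply]
    by_cases h0 : h γ = 0
    · refine Finset.prod_eq_zero (i := 1) ?_ ?_
      · simp [Polynomial.mem_nthRootsFinset hk]
      · rw [h0, zero_pow hk.ne', pow_eq_zero_iff hk.ne'] at hγ
        simp [f', h', h0, hγ]
    · refine Finset.prod_eq_zero (i := f γ / h γ) ?_ ?_
      · rw [Polynomial.mem_nthRootsFinset hk, div_pow, hγ, div_self (pow_ne_zero k h0)]
      · simp [f', h', h0]
  obtain ⟨ζ, -, hζ⟩ := (Ideal.IsPrime.prod_mem_iff (p := p)).mp (hprod ▸ p.zero_mem)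
  have hζ1 : ζ = 1 := by
    have : f 1 - ζ * h 1 = 0 := hpm hζ
    rw [hone, sub_eq_zero] at this
    exact (mul_right_cancel₀ hne ((one_mul _).trans this)).symm
  rw [hζ1, one_smul] at hζ
  refine ⟨(MulAction.stabilizer Γ p).normalCore, inferInstance, inferInstance, fun γ hγ => ?_⟩
  have hstab : γ • p = p := Subgroup.normalCore_le _ hγ
  have hmem : γ • (f' - h') ∈ p := by
    have := Ideal.smul_mem_pointwise_smul γ _ _ hζ
    rwa [hstab] at this
  have : f (1 * γ) - h (1 * γ) = 0 := hpm hmem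
  rwa [one_mul, sub_eq_zero] at this

theorem Algebra.comp_mul_right_mem_adjoin {S : Set (Γ → F)}
    (hS : ∀ g : Γ, ∀ f ∈ S, (fun x => f (x * g)) ∈ Submodule.span F S) (g : Γ)
    {f : Γ → F} (hf : f ∈ Algebra.adjoin F S) :
    (fun x => f (x * g)) ∈ Algebra.adjoin F S := by
  induction hf using Algebra.adjoin_induction with
  | mem f hf => exact Algebra.span_le_adjoin F S (hS g f hf)
  | algebraMap r => exact (Algebra.adjoin F S).algebraMap_mem r
  | add f₁ f₂ _ _ h₁ h₂ => exact (Algebra.adjoin F S).add_mem h₁ h₂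
  | mul f₁ f₂ _ _ h₁ h₂ => exact (Algebra.adjoin F S).mul_mem h₁ h₂

namespace Representation

variable {V : Type*} [AddCommGroup V] [Module F V] {ι : Type*} [Fintype ι]

/-- The matrix coefficients of a representation in a basis. -/
noncomputable def matrixCoeff (ρ : Representation F Γ V) (b : Module.Basis ι F V) (ij : ι × ι) :
    Γ → F :=
  fun γ => b.repr (ρ γ (b ij.2)) ij.1

theorem matrixCoeff_mul_right_mem_span (ρ : Representation F Γ V) (b : Module.Basis ι F V)
    (g : Γ) (ij : ι × ι) :
    (fun x => ρ.matrixCoeff b ij (x * g)) ∈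
      Submodule.span F (Set.range (ρ.matrixCoeff b)) := by
  have : (fun x => ρ.matrixCoeff b ij (x * g)) =
      ∑ l, b.repr (ρ g (b ij.2)) l • ρ.matrixCoeff b (ij.1, l) := by
    funext x
    simp only [matrixCoeff, map_mul, Module.End.mul_apply]
    conv_lhs => rw [← b.sum_repr (ρ g (b ij.2))]
    simp only [map_sum, map_smul, Finsupp.finsetSum_apply, Finsupp.smul_apply, Finset.sum_apply,
      Pi.smul_apply, matrixCoeff]
  rw [this]
  exact Submodule.sum_mem _ fun l _ =>
    Submodule.smul_mem _ _ (Submodule.subset_span (Set.mem_range_self _))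

theorem character_mem_span_matrixCoeff (ρ : Representation F Γ V) (b : Module.Basis ι F V) :
    (fun γ => LinearMap.trace F V (ρ γ)) ∈
      Submodule.span F (Set.range (ρ.matrixCoeff b)) := by
  classical
  have : (fun γ => LinearMap.trace F V (ρ γ)) = ∑ i, ρ.matrixCoeff b (i, i) := by
    funext γ
    simp [LinearMap.trace_eq_matrix_trace F b, Matrix.trace, LinearMap.toMatrix_apply, matrixCoeff]
  rw [this]
  exact Submodule.sum_mem _ fun l _ => Submodule.subset_span (Set.mem_range_self _)

theorem exists_finiteIndex_trace_eq_of_trace_pow_eq {V₁ V₂ : Type*} [CharZero F]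
    [AddCommGroup V₁] [Module F V₁] [FiniteDimensional F V₁]
    [AddCommGroup V₂] [Module F V₂] [FiniteDimensional F V₂]
    (ρ₁ : Representation F Γ V₁) (ρ₂ : Representation F Γ V₂)
    (hdim : Module.finrank F V₁ = Module.finrank F V₂) (hpos : 0 < Module.finrank F V₂)
    {k : ℕ} (hk : 0 < k)
    (h : ∀ γ, LinearMap.trace F V₁ (ρ₁ γ) ^ k = LinearMap.trace F V₂ (ρ₂ γ) ^ k) :
    ∃ N : Subgroup Γ, N.Normal ∧ N.FiniteIndex ∧
      ∀ γ ∈ N, LinearMap.trace F V₁ (ρ₁ γ) = LinearMap.trace F V₂ (ρ₂ γ) := by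
  let S₁ := Set.range (ρ₁.matrixCoeff (Module.finBasis F V₁))
  let S₂ := Set.range (ρ₂.matrixCoeff (Module.finBasis F V₂))
  have hS : ∀ g : Γ, ∀ f ∈ S₁ ∪ S₂, (fun x => f (x * g)) ∈ Submodule.span F (S₁ ∪ S₂) := by
    rintro g _ (⟨ij, rfl⟩ | ⟨ij, rfl⟩)
    · exact Submodule.span_mono Set.subset_union_left (matrixCoeff_mul_right_mem_span ρ₁ _ g ij)
    · exact Submodule.span_mono Set.subset_union_right (matrixCoeff_mul_right_mem_span ρ₂ _ g ij)
  refine (Algebra.adjoin F (S₁ ∪ S₂)).exists_finiteIndex_eqOn_of_pow_eq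
    (Subalgebra.fg_def.mpr ⟨_, (Set.finite_range _).union (Set.finite_range _), rfl⟩)
    (fun g f hf => Algebra.comp_mul_right_mem_adjoin hS g hf)
    (Algebra.span_le_adjoin F _ (Submodule.span_mono Set.subset_union_left
      (character_mem_span_matrixCoeff ρ₁ _)))
    (Algebra.span_le_adjoin F _ (Submodule.span_mono Set.subset_union_right
      (character_mem_span_matrixCoeff ρ₂ _))) hk (funext h) ?_ ?_
  · simp [hdim]
  · simpa using hpos.ne'

end Representation

end RightTranslation

namespace Representation

variable {F Γ V : Type*} [Field F] [Group Γ] [AddCommGroup V] [Module F V]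

/-- Elements of `Γ` permute the subrepresentations of the restriction to a normal subgroup. -/
def mapSubrepresentation (ρ : Representation F Γ V) (N : Subgroup Γ) [N.Normal] (g : Γ)
    (W : Subrepresentation (ρ.comp N.subtype)) : Subrepresentation (ρ.comp N.subtype) where
  toSubmodule := W.toSubmodule.map (ρ g)
  apply_mem_toSubmodule := by
    rintro n _ ⟨w, hw, rfl⟩
    let n' : N := ⟨g⁻¹ * n * g, by
      simpa using ‹N.Normal›.conj_mem n n.2 g⁻¹⟩
    refine ⟨ρ n' w, W.apply_mem_toSubmodule n' hw, ?_⟩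
    change ρ g (ρ (g⁻¹ * n * g) w) = ρ n (ρ g w)
    rw [← Module.End.mul_apply, ← Module.End.mul_apply, ← map_mul, ← map_mul]
    group

/-- The order automorphism of the lattice of subrepresentations of the restriction to a normal
subgroup given by an element of `Γ`. -/
def subrepresentationOrderIso (ρ : Representation F Γ V) (N : Subgroup Γ) [N.Normal] (g : Γ) :
    Subrepresentation (ρ.comp N.subtype) ≃o Subrepresentation (ρ.comp N.subtype) where
  toFun := ρ.mapSubrepresentation N g
  invFun := ρ.mapSubrepresentation N g⁻¹
  left_inv W := Subrepresentation.toSubmodule_injective <| by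
    simp [mapSubrepresentation, ← Submodule.map_comp, ← Module.End.mul_eq_comp, ← map_mul,
      Module.End.one_eq_id]
  right_inv W := Subrepresentation.toSubmodule_injective <| by
    simp [mapSubrepresentation, ← Submodule.map_comp, ← Module.End.mul_eq_comp, ← map_mul,
      Module.End.one_eq_id]
  map_rel_iff' {W₁ W₂} :=
    Submodule.map_le_map_iff_of_injective (ρ.apply_bijective g).injective _ _

theorem IsSemisimpleRep.isSemisimpleModule_asModule_restrict [FiniteDimensional F V]
    {ρ : Representation F Γ V} (hρ : ρ.IsSemisimpleRep) (N : Subgroup Γ) [N.Normal] :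
    IsSemisimpleModule (MonoidAlgebra F N) (asModule (ρ.comp N.subtype)) := by
  let σ : Representation F N V := ρ.comp N.subtype
  let e : Subrepresentation σ ≃o Submodule (MonoidAlgebra F N) σ.asModule :=
    Subrepresentation.subrepresentationSubmoduleOrderIso
  let S : Submodule (MonoidAlgebra F N) σ.asModule := sSup {W | IsAtom W}
  have hS : ∀ γ : Γ, ∀ v ∈ (e.symm S).toSubmodule, ρ γ v ∈ (e.symm S).toSubmodule := by
    intro γ v hv
    let ψ := (e.symm.trans (ρ.subrepresentationOrderIso N γ)).trans e
    have hψ : ψ S ≤ S := by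
      rw [OrderIso.map_sSup]
      exact iSup₂_le fun W hW => le_sSup ((OrderIso.isAtom_iff ψ W).mpr hW)
    have hle : ρ.subrepresentationOrderIso N γ (e.symm S) ≤ e.symm S := e.le_symm_apply.mpr hψ
    exact hle (Submodule.mem_map_of_mem hv)
  obtain ⟨W', hW', hcompl⟩ := hρ _ hS
  let T : Subrepresentation σ := ⟨W', fun n v hv => hW' n v hv⟩
  have : IsArtinian (MonoidAlgebra F N) σ.asModule := isArtinian_of_tower F inferInstance
  have hT : e T = ⊥ := by
    refine (IsAtomic.eq_bot_or_exists_atom_le (e T)).resolve_right ?_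
    rintro ⟨W, hW, hle⟩
    refine hW.1 (e.symm.injective ?_)
    rw [map_bot]
    apply Subrepresentation.toSubmodule_injective
    exact le_bot_iff.mp (hcompl.disjoint (e.symm.monotone (le_sSup hW)) (e.symm_apply_le.mpr hle))
  have hT' : W' = ⊥ := by
    have : T = ⊥ := by rw [← e.symm_apply_apply T, hT, map_bot]
    exact congrArg Subrepresentation.toSubmodule this
  refine isSemisimpleModule_iff _ _ |>.mpr (complementedLattice_of_sSup_atoms_eq_top ?_)
  have hStop : e.symm S = ⊤ := Subrepresentation.toSubmodule_injective <| by
    have := hcompl.sup_eq_top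
    rwa [hT', sup_bot_eq] at this
  change S = ⊤
  rw [← e.apply_symm_apply S, hStop, map_top]

theorem exists_linearEquiv_of_trace_eq [CharZero F] {V₁ V₂ : Type*}
    [AddCommGroup V₁] [Module F V₁] [FiniteDimensional F V₁]
    [AddCommGroup V₂] [Module F V₂] [FiniteDimensional F V₂]
    (σ₁ : Representation F Γ V₁) (σ₂ : Representation F Γ V₂)
    (h₁ : IsSemisimpleModule (MonoidAlgebra F Γ) σ₁.asModule)
    (h₂ : IsSemisimpleModule (MonoidAlgebra F Γ) σ₂.asModule)
    (h : ∀ γ, LinearMap.trace F V₁ (σ₁ γ) = LinearMap.trace F V₂ (σ₂ γ)) :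
    ∃ e : V₁ ≃ₗ[F] V₂, ∀ γ v, e (σ₁ γ v) = σ₂ γ (e v) := by
  have htr (a : MonoidAlgebra F Γ) :
      LinearMap.trace F σ₁.asModule (Algebra.lsmul F F _ a) =
        LinearMap.trace F σ₂.asModule (Algebra.lsmul F F _ a) := by
    have h' : LinearMap.trace F V₁ (σ₁.asAlgebraHom a) =
        LinearMap.trace F V₂ (σ₂.asAlgebraHom a) := by
      induction a using MonoidAlgebra.induction_linear with
      | zero => simp
      | add f g hf hg => simp [hf, hg]
      | single g r => simp [asAlgebraHom_single, h]
    exact h'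
  obtain ⟨e⟩ := nonempty_linearEquiv_of_trace_lsmul_eq htr
  refine ⟨σ₁.asModuleEquiv.symm ≪≫ₗ e.restrictScalars F ≪≫ₗ σ₂.asModuleEquiv, fun γ v => ?_⟩
  simp only [LinearEquiv.trans_apply, LinearEquiv.restrictScalars_apply]
  rw [asModuleEquiv_symm_map_rho, map_smul, asModuleEquiv_map_smul, asAlgebraHom_of]

end Representation

/-- If two semisimple `n`-dimensional representations of a group `Γ` over a field of
characteristic zero have isomorphic `k`-th tensor power representations for some `k ≥ 1`,
then they are potentially isomorphic: their restrictions to some finite-index subgroup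
of `Γ` are isomorphic. -/
theorem potentially_isomorphic_of_tensorPower_iso
    (Γ : Type*) [Group Γ] (F : Type*) [Field F] [CharZero F]
    (V₁ V₂ : Type*) [AddCommGroup V₁] [Module F V₁] [AddCommGroup V₂] [Module F V₂]
    (n : ℕ) (hn : 0 < n)
    [FiniteDimensional F V₁] [FiniteDimensional F V₂]
    (hdim₁ : Module.finrank F V₁ = n) (hdim₂ : Module.finrank F V₂ = n)
    (ρ₁ : Representation F Γ V₁) (ρ₂ : Representation F Γ V₂)
    (hss₁ : ρ₁.IsSemisimpleRep) (hss₂ : ρ₂.IsSemisimpleRep)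
    (k : ℕ) (hk : 0 < k)
    -- the `k`-th tensor power representations are isomorphic:
    (hiso : ∃ e : (⨂[F]^k V₁) ≃ₗ[F] (⨂[F]^k V₂), ∀ γ : Γ, ∀ x : ⨂[F]^k V₁,
      e (PiTensorProduct.map (fun _ : Fin k => ρ₁ γ) x) =
        PiTensorProduct.map (fun _ : Fin k => ρ₂ γ) (e x)) :
    ∃ Γ' : Subgroup Γ, Γ'.FiniteIndex ∧
      ∃ e : V₁ ≃ₗ[F] V₂, ∀ γ ∈ Γ', ∀ v : V₁, e (ρ₁ γ v) = ρ₂ γ (e v) := by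
  obtain ⟨e, he⟩ := hiso
  have hpow (γ : Γ) : LinearMap.trace F V₁ (ρ₁ γ) ^ k = LinearMap.trace F V₂ (ρ₂ γ) ^ k := by
    have hconj : e.conj (PiTensorProduct.map fun _ : Fin k => ρ₁ γ) =
        PiTensorProduct.map fun _ : Fin k => ρ₂ γ :=
      LinearMap.ext fun x => by simp [LinearEquiv.conj_apply, he]
    have htr := LinearMap.trace_conj' (PiTensorProduct.map fun _ : Fin k => ρ₁ γ) e
    rw [hconj, PiTensorProduct.trace_map_const, PiTensorProduct.trace_map_const,
      Fintype.card_fin] at htr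
    exact htr.symm
  obtain ⟨N, hN, hfin, htr⟩ := ρ₁.exists_finiteIndex_trace_eq_of_trace_pow_eq ρ₂
    (hdim₁.trans hdim₂.symm) (hdim₂ ▸ hn) hk hpow
  obtain ⟨e', he'⟩ := Representation.exists_linearEquiv_of_trace_eq
    (ρ₁.comp N.subtype) (ρ₂.comp N.subtype)
    (hss₁.isSemisimpleModule_asModule_restrict N) (hss₂.isSemisimpleModule_asModule_restrict N)
    fun γ => htr γ γ.2
  exact ⟨N, hfin, e', fun γ hγ v => he' ⟨γ, hγ⟩ v⟩
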